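/- (Deterministic form of Ben-David et al.'s adaptation bound, Theorem 1 of the paper.) Let X be a measurable space, μ_s, μ_t probability measures on X, f_s, f_t : X → ℝ measurable functions with values in [0,1], and let H be a nonempty set of measurable hypotheses X → ℝ with values in {0,1}. Define ε_s(h) := ∫ |h − f_s| dμ_s, ε_t(h) := ∫ |h − f_t| dμ_t, the H∆H-distance d_{H∆H}(μ_s, μ_t) := 2 · sup_{h,h' ∈ H} |μ_s{x : h(x) ≠ h'(x)} − μ_t{x : h(x) ≠ h'(x)}|, and λ := inf_{h ∈ H} (ε_s(h) + ε_t(h)). Then for every h ∈ H, ε_s(h) ≤ ε_t(h) + (1/2) · d_{H∆H}(μ_s, μ_t) + λ. -/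

import Mathlib

open MeasureTheory

theorem integrable_abs_sub_of_mem_Icc {X : Type*} [MeasurableSpace X] {μ : Measure X}
    [IsFiniteMeasure μ] {f g : X → ℝ} (hf : Measurable f) (hg : Measurable g)
    (hf01 : ∀ x, f x ∈ Set.Icc (0 : ℝ) 1) (hg01 : ∀ x, g x ∈ Set.Icc (0 : ℝ) 1) :
    Integrable (fun x => |f x - g x|) μ := by
  refine Integrable.of_bound (hf.sub hg).abs.aestronglyMeasurable 1 (ae_of_all _ fun x => ?_)
  rw [Real.norm_eq_abs, abs_abs, abs_le]
  constructor <;> linarith [(hf01 x).1, (hf01 x).2, (hg01 x).1, (hg01 x).2]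

/-- The triangle inequality for the `L¹` distance between `[0,1]`-valued functions. -/
theorem integral_abs_sub_le_of_mem_Icc {X : Type*} [MeasurableSpace X] (μ : Measure X)
    [IsFiniteMeasure μ] {f g k : X → ℝ} (hf : Measurable f) (hg : Measurable g)
    (hk : Measurable k) (hf01 : ∀ x, f x ∈ Set.Icc (0 : ℝ) 1)
    (hg01 : ∀ x, g x ∈ Set.Icc (0 : ℝ) 1) (hk01 : ∀ x, k x ∈ Set.Icc (0 : ℝ) 1) :
    ∫ x, |f x - k x| ∂μ ≤ ∫ x, |f x - g x| ∂μ + ∫ x, |g x - k x| ∂μ := by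
  have hfg : Integrable (fun x => |f x - g x|) μ := integrable_abs_sub_of_mem_Icc hf hg hf01 hg01
  have hgk : Integrable (fun x => |g x - k x|) μ := integrable_abs_sub_of_mem_Icc hg hk hg01 hk01
  rw [← integral_add hfg hgk]
  exact integral_mono (integrable_abs_sub_of_mem_Icc hf hk hf01 hk01) (hfg.add hgk)
    fun x => abs_sub_le _ _ _

/-- The `L¹` distance of two `{0,1}`-valued functions is the measure of their disagreement set. -/
theorem integral_abs_sub_eq_measure_ne {X : Type*} [MeasurableSpace X] (μ : Measure X)
    {f g : X → ℝ} (hf : Measurable f) (hg : Measurable g)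
    (hf01 : ∀ x, f x = 0 ∨ f x = 1) (hg01 : ∀ x, g x = 0 ∨ g x = 1) :
    ∫ x, |f x - g x| ∂μ = (μ {x | f x ≠ g x}).toReal := by
  have hset : MeasurableSet {x | f x ≠ g x} := (measurableSet_eq_fun hf hg).compl
  have heq : (fun x => |f x - g x|) = {x | f x ≠ g x}.indicator 1 := by
    funext x
    rcases hf01 x with h | h <;> rcases hg01 x with h' | h' <;> simp [Set.indicator, h, h']
  rw [heq, integral_indicator_one hset, measureReal_def]

/-- Deterministic form of Ben-David et al.'s adaptation bound: for every `h` in a nonempty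
class `H` of measurable `{0,1}`-valued hypotheses,
`εs(h) ≤ εt(h) + (1/2) · d_{H∆H}(μs, μt) + λ`, where
`d_{H∆H}(μs, μt) = 2 · sup_{h,h' ∈ H} |μs{h ≠ h'} − μt{h ≠ h'}|` and
`λ = inf_{h ∈ H} (εs(h) + εt(h))`. -/
theorem ben_david_adaptation_bound
    {X : Type*} [MeasurableSpace X]
    (μs μt : Measure X) [IsProbabilityMeasure μs] [IsProbabilityMeasure μt]
    (fs ft : X → ℝ) (hfs : Measurable fs) (hft : Measurable ft)
    (hfs01 : ∀ x, fs x ∈ Set.Icc (0 : ℝ) 1) (hft01 : ∀ x, ft x ∈ Set.Icc (0 : ℝ) 1)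
    (H : Set (X → ℝ)) (hHne : H.Nonempty)
    (hHmeas : ∀ h ∈ H, Measurable h) (hHbin : ∀ h ∈ H, ∀ x, h x = 0 ∨ h x = 1)
    (εs εt : (X → ℝ) → ℝ)
    (hεs : ∀ h, εs h = ∫ x, |h x - fs x| ∂μs)
    (hεt : ∀ h, εt h = ∫ x, |h x - ft x| ∂μt)
    (dH : ℝ)
    (hdH : dH = 2 * sSup ((fun p : (X → ℝ) × (X → ℝ) =>
        |(μs {x | p.1 x ≠ p.2 x}).toReal - (μt {x | p.1 x ≠ p.2 x}).toReal|) '' (H ×ˢ H)))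
    (lam : ℝ) (hlam : lam = sInf ((fun h => εs h + εt h) '' H)) :
    ∀ h ∈ H, εs h ≤ εt h + (1 / 2) * dH + lam := by
  have hH01 : ∀ h ∈ H, ∀ x, h x ∈ Set.Icc (0 : ℝ) 1 := by
    intro h hh x
    rcases hHbin h hh x with hx | hx <;> simp [hx]
  intro h hh
  have hlow : εs h - εt h - (1 / 2) * dH ≤ lam := by
    rw [hlam]
    refine le_csInf (hHne.image _) ?_
    rintro _ ⟨g, hg, rfl⟩
    have hs := integral_abs_sub_le_of_mem_Icc μs (hHmeas h hh) (hHmeas g hg) hfs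
      (hH01 h hh) (hH01 g hg) hfs01
    have ht := integral_abs_sub_le_of_mem_Icc μt (hHmeas h hh) hft (hHmeas g hg)
      (hH01 h hh) hft01 (hH01 g hg)
    rw [integral_abs_sub_eq_measure_ne μs (hHmeas h hh) (hHmeas g hg) (hHbin h hh)
      (hHbin g hg)] at hs
    rw [integral_abs_sub_eq_measure_ne μt (hHmeas h hh) (hHmeas g hg) (hHbin h hh)
      (hHbin g hg)] at ht
    simp only [abs_sub_comm (ft _) (g _)] at ht
    have hbdd : BddAbove ((fun p : (X → ℝ) × (X → ℝ) =>
        |(μs {x | p.1 x ≠ p.2 x}).toReal - (μt {x | p.1 x ≠ p.2 x}).toReal|) '' (H ×ˢ H)) := by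
      refine ⟨1, ?_⟩
      rintro _ ⟨p, -, rfl⟩
      simp only [← measureReal_def]
      exact abs_sub_le_of_nonneg_of_le measureReal_nonneg measureReal_le_one
        measureReal_nonneg measureReal_le_one
    have hd := (le_abs_self _).trans
      (le_csSup hbdd (Set.mem_image_of_mem _ (Set.mk_mem_prod hh hg)))
    dsimp only at hd ⊢
    rw [← hεs, ← hεs] at hs
    rw [← hεt, ← hεt] at ht
    linarith
  linarith
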